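/- Let s ≥ m - 1 ≥ 1 be integers. Then there exists f(s,m) such that for every integer t ≥ f(s,m) there are constants C_2 > C_1 > 0 with C_1 · n^{m - m(m-1)/(2s)} ≤ ex(n, K_m, K_{s,t}) ≤ C_2 · n^{m - m(m-1)/(2s)} for all sufficiently large n. -/

import Mathlib

/-- A graph `G` contains a copy of `K_{s,t}`. -/
def ContainsKst {n : ℕ} (G : SimpleGraph (Fin n)) (s t : ℕ) : Prop :=
  ∃ A B : Finset (Fin n), Disjoint A B ∧ A.card = s ∧ B.card = t ∧
    ∀ a ∈ A, ∀ b ∈ B, G.Adj a b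

/-- If a valuation ring contains all `∏ i, (x i + a i j)` and all `a i j`, and the differences
`a i j - a i k` are units of it, then it contains every `x i`. -/
theorem ValuationSubring.mem_of_prod_add_mem {L σ : Type*} [Field L] [Fintype σ]
    (V : ValuationSubring L) (x : σ → L) (a : σ → σ → L) (ha : ∀ i j, a i j ∈ V)
    (hd : ∀ i j j', j ≠ j' → V.valuation (a i j - a i j') = 1)
    (hx : ∀ j, ∏ i, (x i + a i j) ∈ V) (i : σ) : x i ∈ V := by
  classical
  by_contra hi
  have hi' : 1 < V.valuation (x i) := by
    rw [← not_le, V.valuation_le_one_iff]; exact hi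
  have key : ∀ j, ∃ l : {l : σ // l ≠ i}, V.valuation (x l + a l j) < 1 := by
    intro j
    by_contra! h
    have h1 : 1 < V.valuation (x i + a i j) := by
      rw [Valuation.map_add_eq_of_lt_left]
      · exact hi'
      · exact ((V.valuation_le_one_iff _).2 (ha i j)).trans_lt hi'
    have h2 := (V.valuation_le_one_iff _).2 (hx j)
    rw [map_prod, ← Finset.mul_prod_erase _ _ (Finset.mem_univ i)] at h2
    have h3 : 1 ≤ ∏ l ∈ Finset.univ.erase i, V.valuation (x l + a l j) :=
      Finset.one_le_prod' fun l hl => h ⟨l, Finset.ne_of_mem_erase hl⟩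
    exact absurd (h1.trans_le (le_mul_of_one_le_right' h3)) (not_lt.2 h2)
  choose f hf using key
  obtain ⟨j, j', hne, hjj⟩ := Fintype.exists_ne_map_eq_of_card_lt f
    (Fintype.card_subtype_lt (x := i) (by simp))
  have h4 : V.valuation ((x (f j) + a (f j) j) - (x (f j) + a (f j) j')) < 1 :=
    (V.valuation.map_sub _ _).trans_lt (max_lt (hf j) (by rw [hjj]; exact hf j'))
  rw [add_sub_add_left_eq_sub, hd _ _ _ hne] at h4
  exact lt_irrefl _ h4

open MvPolynomial in
/-- The polynomial ring is integral over the subring generated by the polynomials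
`∏ i, (X i + a i j)` when the differences `a i j - a i k` are units. -/
theorem MvPolynomial.isIntegralElem_X_of_prod {R σ : Type*} [CommRing R] [IsDomain R] [Fintype σ]
    (a : σ → σ → R) (ha : ∀ i j j', j ≠ j' → IsUnit (a i j - a i j')) (i : σ) :
    (aeval fun j => ∏ i, (X i + C (a i j)) :
      MvPolynomial σ R →ₐ[R] MvPolynomial σ R).toRingHom.IsIntegralElem (X i) := by
  set F : MvPolynomial σ R →ₐ[R] MvPolynomial σ R := aeval fun j => ∏ i, (X i + C (a i j))
  let L := FractionRing (MvPolynomial σ R)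
  let g : MvPolynomial σ R →+* L := (algebraMap (MvPolynomial σ R) L).comp F.toRingHom
  have hmem : algebraMap (MvPolynomial σ R) L (X i) ∈
      (integralClosure (Subring.closure (g.range : Set L)) L).toSubring := by
    rw [← iInf_valuationSubring_superset, Subring.mem_iInf]
    rintro ⟨V, hV⟩
    have hC : ∀ r : R, algebraMap (MvPolynomial σ R) L (C r) ∈ V := fun r =>
      hV ⟨C r, by simp [g]⟩
    refine V.mem_of_prod_add_mem (fun i => algebraMap (MvPolynomial σ R) L (X i))
      (fun i j => algebraMap (MvPolynomial σ R) L (C (a i j))) (fun i j => hC _) ?_ ?_ i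
    · intro i j j' hj
      obtain ⟨u, hu⟩ := ha i j j' hj
      rw [← map_sub, ← map_sub, ← hu]
      have h1 := (V.valuation_le_one_iff _).2 (hC u)
      have h2 := (V.valuation_le_one_iff _).2 (hC (u⁻¹ : Rˣ))
      have h3 : V.valuation (algebraMap (MvPolynomial σ R) L (C (u : R))) *
          V.valuation (algebraMap (MvPolynomial σ R) L (C ((u⁻¹ : Rˣ) : R))) = 1 := by
        rw [← map_mul, ← map_mul, ← map_mul]; simp
      refine le_antisymm h1 ?_
      rw [← h3]
      exact mul_le_of_le_one_right' h2
    · intro j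
      exact hV ⟨X j, by simp [g, F]⟩
  have hint : IsIntegral (Subring.closure (g.range : Set L))
      (algebraMap (MvPolynomial σ R) L (X i)) := hmem
  obtain ⟨p, hp, hpx⟩ := hint
  have hcl : ∀ y : Subring.closure (g.range : Set L), ∃ z, g z = y := fun y => by
    simpa using (Subring.closure_eq g.range).le y.2
  let g' : MvPolynomial σ R →+* Subring.closure (g.range : Set L) :=
    g.codRestrict _ fun z => Subring.subset_closure ⟨z, rfl⟩
  have hsurj : Function.Surjective g' := fun y => by
    obtain ⟨z, hz⟩ := hcl y
    exact ⟨z, Subtype.ext hz⟩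
  obtain ⟨P, hP, -, hPm⟩ := Polynomial.lifts_and_natDegree_eq_and_monic
    ((Polynomial.mem_lifts p).2 (Polynomial.map_surjective g' hsurj p)) hp
  refine ⟨P, hPm, IsFractionRing.injective (MvPolynomial σ R) L ?_⟩
  rw [← hP, Polynomial.eval₂_map] at hpx
  rw [Polynomial.hom_eval₂, map_zero]
  exact hpx

open MvPolynomial in
/-- The number of values taken by a coordinate of a solution to the system
`∏ i, (x i + a i j) = b j` over a field is bounded uniformly in the field and the parameters. -/
theorem exists_degree_bound_prod_add_eq (σ : Type) [Fintype σ] (i : σ) :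
    ∃ D : ℕ, ∀ (K : Type) [Field K] (a : σ → σ → K), (∀ i, Function.Injective (a i)) →
      ∀ b : σ → K, ∃ p : Polynomial K, p ≠ 0 ∧ p.natDegree ≤ D ∧
        ∀ x : σ → K, (∀ j, ∏ i, (x i + a i j) = b j) → p.IsRoot (x i) := by
  classical
  let A := MvPolynomial (σ × σ) ℤ
  let Δ : A := ∏ i : σ, ∏ j : σ, ∏ j' ∈ Finset.univ.erase j, (X (i, j) - X (i, j'))
  have hΔ : Δ ≠ 0 := by
    refine Finset.prod_ne_zero_iff.2 fun i _ => Finset.prod_ne_zero_iff.2 fun j _ =>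
      Finset.prod_ne_zero_iff.2 fun j' hj' => ?_
    rw [sub_ne_zero]
    intro h
    have := X_injective h
    simp only [Prod.mk.injEq, true_and] at this
    exact (Finset.ne_of_mem_erase hj').symm this
  let R := Localization.Away Δ
  have : IsDomain R := IsLocalization.isDomain_localization
    (powers_le_nonZeroDivisors_of_noZeroDivisors hΔ)
  let α : σ → σ → R := fun i j => algebraMap A R (X (i, j))
  have hα : ∀ i j j', j ≠ j' → IsUnit (α i j - α i j') := by
    intro i j j' hj
    rw [← map_sub]
    refine isUnit_of_dvd_unit (map_dvd (algebraMap A R) ?_)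
      (IsLocalization.Away.algebraMap_isUnit (S := R) Δ)
    exact (Finset.dvd_prod_of_mem (fun j' => (X (i, j) - X (i, j') : A))
      (Finset.mem_erase.2 ⟨hj.symm, Finset.mem_univ _⟩)).trans
      ((Finset.dvd_prod_of_mem (fun j => ∏ j' ∈ Finset.univ.erase j, (X (i, j) - X (i, j') : A))
        (Finset.mem_univ j)).trans
      (Finset.dvd_prod_of_mem (fun i => ∏ j, ∏ j' ∈ Finset.univ.erase j,
        (X (i, j) - X (i, j') : A)) (Finset.mem_univ i)))
  obtain ⟨P, hP, hPX⟩ := MvPolynomial.isIntegralElem_X_of_prod α hα i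
  refine ⟨P.natDegree, fun K _ a ha b => ?_⟩
  let φ₀ : A →+* K := eval₂Hom (Int.castRingHom K) fun q : σ × σ => a q.1 q.2
  have hφX : ∀ q : σ × σ, φ₀ (X q) = a q.1 q.2 := fun q => eval₂Hom_X' _ _ q
  have hφ₀ : IsUnit (φ₀ Δ) := by
    rw [isUnit_iff_ne_zero]
    simp only [Δ, map_prod, Finset.prod_ne_zero_iff]
    intro i _ j _ j' hj'
    rw [map_sub, hφX, hφX, sub_ne_zero]
    exact fun h => (Finset.ne_of_mem_erase hj').symm (ha i h)
  let φ : R →+* K := IsLocalization.Away.lift Δ hφ₀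
  have hφα : ∀ i j, φ (α i j) = a i j := fun i j => by
    simp only [φ, α, IsLocalization.Away.lift_eq, hφX]
  refine ⟨P.map (eval₂Hom φ b), (hP.map _).ne_zero, (hP.natDegree_map _).le, fun x hx => ?_⟩
  have hcomp : (eval₂Hom φ x).comp (aeval fun j => ∏ i, (X i + C (α i j)) :
      MvPolynomial σ R →ₐ[R] MvPolynomial σ R).toRingHom = eval₂Hom φ b := by
    refine MvPolynomial.ringHom_ext (fun r => by simp) fun j => ?_
    simp [hφα, hx]
  have := congrArg (eval₂Hom φ x) hPX
  rw [Polynomial.hom_eval₂, hcomp, map_zero, coe_eval₂Hom, eval₂_X] at this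
  rw [Polynomial.IsRoot.def, Polynomial.eval_map]
  exact this

/-- For `s` distinct points `x j` of `𝔽_{p^s}`, the number of `y` with prescribed norms of
`x j + y` is bounded in terms of `s` only. -/
theorem exists_bound_card_norm_add_eq (s : ℕ) (hs : s ≠ 0) :
    ∃ D : ℕ, ∀ (p : ℕ) [Fact p.Prime] (x : Fin s → GaloisField p s), Function.Injective x →
      ∀ c : Fin s → ZMod p, ∃ Y : Finset (GaloisField p s), Y.card ≤ D ∧
        ∀ y, (∀ j, Algebra.norm (ZMod p) (x j + y) = c j) → y ∈ Y := by
  classical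
  obtain ⟨D, hD⟩ := exists_degree_bound_prod_add_eq (Fin s) ⟨0, Nat.pos_of_ne_zero hs⟩
  refine ⟨D, fun p _ x hx c => ?_⟩
  have hfrob : ∀ i : ℕ, Function.Injective fun y : GaloisField p s => y ^ p ^ i := fun i =>
    iterateFrobenius_inj (GaloisField p s) p i
  obtain ⟨P, hP0, hPD, hP⟩ := hD (GaloisField p s) (fun i j => x j ^ p ^ (i : ℕ))
    (fun i => (hfrob i).comp hx) (fun j => algebraMap (ZMod p) _ (c j))
  refine ⟨P.roots.toFinset, (Multiset.toFinset_card_le _).trans ((Polynomial.card_roots' P).trans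
    hPD), fun y hy => ?_⟩
  rw [Multiset.mem_toFinset, Polynomial.mem_roots hP0]
  have := hP (fun i => y ^ p ^ (i : ℕ)) fun j => ?_
  · simpa using this
  · rw [← hy j, FiniteField.algebraMap_norm_eq_prod_pow, GaloisField.finrank p hs,
      Finset.prod_range]
    simp [add_pow_char_pow, add_comm]

open Finset in
/-- Colour the pairs of points of `V` so that any `s` distinct points and any choice of colours
admit at most `D` further points. Choosing one colour for each pair of parts of a partition of `V`
into `m` parts, one gets an `m`-partite graph with few common neighbours and many `m`-cliques. -/
theorem exists_graph_of_pair_coloring {V Q : Type*} [Fintype V] [Fintype Q] [Nonempty Q]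
    {s m D k : ℕ}
    (N : Sym2 V → Q) (hN : ∀ x : Fin s → V, Function.Injective x → ∀ c : Fin s → Q,
      ∃ Y : Finset V, #Y ≤ D ∧ ∀ y, (∀ j, N s(x j, y) = c j) → y ∈ Y)
    (col : V → Fin m) (hcol : ∀ i, k ≤ Nat.card {x // col x = i}) :
    ∃ G : SimpleGraph V,
      (∀ A B : Finset V, #A = s → (∀ a ∈ A, ∀ b ∈ B, G.Adj a b) → #B ≤ m * D) ∧
      k ^ m ≤ Fintype.card Q ^ m.choose 2 * Nat.card {S : Finset V // G.IsNClique m S} := by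
  classical
  let T := (i : Fin m) → {x // col x = i}
  let pat : T → ({e : Sym2 (Fin m) // ¬ e.IsDiag} → Q) := fun v e => N (e.1.map fun i => (v i : V))
  obtain ⟨c, hc⟩ : ∃ c, Fintype.card T ≤ Fintype.card Q ^ m.choose 2 * #{v | pat v = c} := by
    by_contra! h
    have hcard : Fintype.card ({e : Sym2 (Fin m) // ¬ e.IsDiag} → Q) =
        Fintype.card Q ^ m.choose 2 := by
      rw [Fintype.card_fun, Sym2.card_subtype_not_diag, Fintype.card_fin]
    have hsum : Fintype.card T = ∑ c, #{v | pat v = c} :=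
      card_eq_sum_card_fiberwise fun _ _ => by simp
    have hlt := sum_lt_sum_of_nonempty univ_nonempty fun c _ => h c
    rw [← mul_sum, ← hsum, sum_const, card_univ, hcard, smul_eq_mul] at hlt
    exact lt_irrefl _ hlt
  let G : SimpleGraph V :=
    { Adj := fun x y => ∃ h : col x ≠ col y, N s(x, y) = c ⟨s(col x, col y), by simpa using h⟩
      symm := ⟨by
        rintro x y ⟨h, hxy⟩
        refine ⟨h.symm, ?_⟩
        rw [Sym2.eq_swap, hxy]
        congr 2
        exact Sym2.eq_swap⟩
      loopless := ⟨fun x ⟨h, _⟩ => h rfl⟩ }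
  refine ⟨G, fun A B hA hAB => ?_, ?_⟩
  · let x : Fin s → V := fun j => (A.equivFinOfCardEq hA).symm j
    have hx : Function.Injective x :=
      Subtype.val_injective.comp (A.equivFinOfCardEq hA).symm.injective
    have hfib : ∀ i : Fin m, #{b ∈ B | col b = i} ≤ D := by
      intro i
      rcases eq_empty_or_nonempty {b ∈ B | col b = i} with h0 | ⟨b₀, hb₀⟩
      · simp [h0]
      obtain ⟨Y, hY, hYm⟩ := hN x hx fun j => N s(x j, b₀)
      refine (card_le_card fun b hb => hYm b fun j => ?_).trans hY
      rw [mem_filter] at hb hb₀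
      have hxj : x j ∈ A := ((A.equivFinOfCardEq hA).symm j).2
      obtain ⟨_, h1⟩ := hAB _ hxj _ hb.1
      obtain ⟨_, h2⟩ := hAB _ hxj _ hb₀.1
      rw [h1, h2]
      congr 3
      rw [hb.2, hb₀.2]
    calc #B = ∑ i : Fin m, #{b ∈ B | col b = i} :=
          card_eq_sum_card_fiberwise fun _ _ => by simp
      _ ≤ ∑ _i : Fin m, D := sum_le_sum fun i _ => hfib i
      _ = m * D := by simp
  · have hT : k ^ m ≤ Fintype.card T := by
      rw [Fintype.card_pi]
      calc k ^ m = ∏ _i : Fin m, k := by simp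
        _ ≤ _ := prod_le_prod' fun i _ => by simpa using hcol i
    refine hT.trans (hc.trans (Nat.mul_le_mul_left _ ?_))
    rw [← Fintype.card_coe, ← Nat.card_eq_fintype_card]
    have hinj : ∀ v : T, Function.Injective fun i => (v i : V) := fun v i j hij => by
      rw [← (v i).2, ← (v j).2]; exact congrArg col hij
    refine Nat.card_le_card_of_injective (fun v : {v // v ∈ univ.filter fun v => pat v = c} =>
      (⟨univ.map ⟨fun i => (v.1 i : V), hinj v.1⟩, ?_⟩ : {S : Finset V // G.IsNClique m S})) ?_
    · refine ⟨?_, by simp⟩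
      intro a ha b hb hab
      simp only [coe_map, coe_univ, Set.image_univ, Set.mem_range, Function.Embedding.coeFn_mk]
        at ha hb
      obtain ⟨i, rfl⟩ := ha
      obtain ⟨j, rfl⟩ := hb
      have hij : i ≠ j := fun h => hab (by rw [h])
      have hv := congrFun (mem_filter.1 v.2).2 ⟨s(i, j), by simpa using hij⟩
      refine ⟨by rwa [(v.1 i).2, (v.1 j).2], ?_⟩
      simp only [pat, Sym2.map_mk] at hv
      rw [hv]
      congr 3
      · exact (v.1 i).2.symm
      · exact (v.1 j).2.symm
    · intro v w hvw
      refine Subtype.ext (funext fun i => Subtype.ext ?_)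
      have h1 : (v.1 i : V) ∈ univ.map ⟨fun i => (w.1 i : V), hinj w.1⟩ := by
        refine (Finset.ext_iff.1 (congrArg Subtype.val hvw) _).1 ?_
        simp
      simp only [mem_map, mem_univ, Function.Embedding.coeFn_mk, true_and] at h1
      obtain ⟨j, hj⟩ := h1
      have hji : j = i := by rw [← (w.1 j).2, ← (v.1 i).2, hj]
      rw [← hj, hji]

theorem Nat.pow_le_mul_choose_add (d s : ℕ) :
    d ^ s ≤ s ^ s * s.factorial * d.choose s + s ^ s := by
  rcases le_total d s with h | h
  · exact (Nat.pow_le_pow_left h s).trans (Nat.le_add_left _ _)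
  · have h1 : d ≤ s * (d + 1 - s) ∨ s = 0 := by
      rcases Nat.eq_zero_or_pos s with h0 | h0
      · exact Or.inr h0
      · left
        obtain ⟨e, rfl⟩ := Nat.exists_eq_add_of_le h
        rw [show s + e + 1 - s = e + 1 by omega]
        nlinarith
    rcases h1 with h1 | rfl
    · have h2 : (d + 1 - s) ^ s ≤ s.factorial * d.choose s := by
        have := Nat.pow_le_choose (α := ℚ) s d
        rw [div_le_iff₀ (by positivity)] at this
        have h3 : (((d + 1 - s) ^ s : ℕ) : ℚ) ≤ ((d.choose s * s.factorial : ℕ) : ℚ) := by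
          push_cast; exact this
        rw [mul_comm]
        exact_mod_cast h3
      calc d ^ s ≤ (s * (d + 1 - s)) ^ s := Nat.pow_le_pow_left h1 s
        _ = s ^ s * (d + 1 - s) ^ s := mul_pow _ _ _
        _ ≤ s ^ s * (s.factorial * d.choose s) := Nat.mul_le_mul_left _ h2
        _ ≤ _ := by rw [mul_assoc]; exact Nat.le_add_right _ _
    · simp

/-- Power mean estimate for a sequence of numbers with `∑ d ^ s ≤ c N ^ s`. -/
theorem sum_rpow_le_of_sum_pow_le {ι : Type*} (U : Finset ι) (hU : U.Nonempty) (d : ι → ℕ)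
    {s : ℕ} (hs : s ≠ 0) {c e : ℝ} (he : 0 ≤ e) (hes : e ≤ s)
    (hd : ∑ v ∈ U, (d v : ℝ) ^ s ≤ c * (U.card : ℝ) ^ s) :
    ∑ v ∈ U, (d v : ℝ) ^ e ≤ (1 + c) * (U.card : ℝ) ^ (1 + e * (1 - 1 / (s : ℝ))) := by
  have hN : (0 : ℝ) < U.card := by exact_mod_cast hU.card_pos
  have hs' : (s : ℝ) ≠ 0 := by exact_mod_cast hs
  set N : ℝ := (U.card : ℝ)
  set M : ℝ := N ^ (1 - 1 / (s : ℝ))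
  have hM : 0 < M := Real.rpow_pos_of_pos hN _
  have hterm : ∀ v ∈ U, (d v : ℝ) ^ e ≤ M ^ e + (d v : ℝ) ^ s * M ^ (e - s) := by
    intro v _
    have hdv : (0 : ℝ) ≤ d v := Nat.cast_nonneg _
    rcases le_total (d v : ℝ) M with h | h
    · exact (Real.rpow_le_rpow hdv h he).trans (le_add_of_nonneg_right (by positivity))
    · have hpos : (0 : ℝ) < d v := hM.trans_le h
      have h1 : (d v : ℝ) ^ e = (d v : ℝ) ^ s * (d v : ℝ) ^ (e - s) := by
        rw [← Real.rpow_natCast, ← Real.rpow_add hpos]; congr 1; ring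
      rw [h1]
      refine le_add_of_nonneg_of_le (by positivity) (mul_le_mul_of_nonneg_left ?_ (by positivity))
      exact Real.rpow_le_rpow_of_nonpos hM h (by linarith)
  have hMe : M ^ e = N ^ (e * (1 - 1 / (s : ℝ))) := by
    rw [← Real.rpow_mul hN.le, mul_comm]
  have hMes : N ^ s * M ^ (e - s) = N * M ^ e := by
    rw [← Real.rpow_mul hN.le, ← Real.rpow_natCast, ← Real.rpow_add hN, hMe]
    nth_rewrite 2 [← Real.rpow_one N]
    rw [← Real.rpow_add hN]
    congr 1
    field_simp
    ring
  calc ∑ v ∈ U, (d v : ℝ) ^ e ≤ ∑ v ∈ U, (M ^ e + (d v : ℝ) ^ s * M ^ (e - s)) :=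
        Finset.sum_le_sum hterm
    _ = N * M ^ e + (∑ v ∈ U, (d v : ℝ) ^ s) * M ^ (e - s) := by
        rw [Finset.sum_add_distrib, Finset.sum_const, nsmul_eq_mul, Finset.sum_mul]
    _ ≤ N * M ^ e + c * N ^ s * M ^ (e - s) := by gcongr
    _ = (1 + c) * (N * M ^ e) := by rw [mul_assoc, hMes]; ring
    _ = _ := by
        rw [hMe, Real.rpow_add hN, Real.rpow_one]

open Classical Finset in
/-- The `K_{s,t}`-free condition bounds the `s`-th moment of the degrees. -/
theorem sum_degree_pow_le {V : Type*} (G : SimpleGraph V) (U : Finset V) {s t : ℕ} (hs : s ≠ 0)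
    (hfree : ∀ A ⊆ U, ∀ B ⊆ U, #A = s → #B = t → ¬ ∀ a ∈ A, ∀ b ∈ B, G.Adj a b) :
    ∑ v ∈ U, #{w ∈ U | G.Adj v w} ^ s ≤ s ^ s * (s.factorial * t + 1) * #U ^ s := by
  have hcount : ∑ v ∈ U, (#{w ∈ U | G.Adj v w}).choose s ≤ t * #U ^ s := by
    have h := sum_card_bipartiteAbove_eq_sum_card_bipartiteBelow
      (fun (v : V) (A : Finset V) => ∀ a ∈ A, G.Adj v a) (s := U) (t := U.powersetCard s)
    have h1 : ∀ v ∈ U, #((U.powersetCard s).bipartiteAbove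
        (fun (v : V) (A : Finset V) => ∀ a ∈ A, G.Adj v a) v) =
        (#{w ∈ U | G.Adj v w}).choose s := by
      intro v _
      rw [← card_powersetCard]
      congr 1
      ext A
      simp only [mem_bipartiteAbove, mem_powersetCard, subset_iff, mem_filter]
      grind
    rw [sum_congr rfl h1] at h
    rw [h]
    calc _ ≤ ∑ _A ∈ U.powersetCard s, t := by
          refine sum_le_sum fun A hA => ?_
          rw [mem_powersetCard] at hA
          by_contra! hlt
          obtain ⟨B, hB, hBt⟩ := exists_subset_card_eq hlt.le
          refine hfree A hA.1 B (hB.trans (filter_subset _ _)) hA.2 hBt fun a ha b hb => ?_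
          exact ((mem_filter.1 (hB hb)).2 a ha).symm
      _ = (#U).choose s * t := by rw [sum_const, card_powersetCard, smul_eq_mul]
      _ ≤ t * #U ^ s := by rw [mul_comm]; exact Nat.mul_le_mul_left _ (Nat.choose_le_pow _ _)
  calc ∑ v ∈ U, #{w ∈ U | G.Adj v w} ^ s
      ≤ ∑ v ∈ U, (s ^ s * s.factorial * (#{w ∈ U | G.Adj v w}).choose s + s ^ s) :=
        sum_le_sum fun v _ => Nat.pow_le_mul_choose_add _ _
    _ = s ^ s * s.factorial * ∑ v ∈ U, (#{w ∈ U | G.Adj v w}).choose s + #U * s ^ s := by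
        rw [sum_add_distrib, mul_sum, sum_const, smul_eq_mul]
    _ ≤ s ^ s * s.factorial * (t * #U ^ s) + #U ^ s * s ^ s :=
        add_le_add (Nat.mul_le_mul_left _ hcount)
          (Nat.mul_le_mul_right _ (Nat.le_self_pow hs _))
    _ = _ := by ring

open Classical Finset in
/-- Upper bound for the number of `(k + 1)`-cliques in a `K_{s,t}`-free graph, `k ≤ s`. -/
theorem exists_card_cliques_le (k s t : ℕ) (hks : k ≤ s) :
    ∃ c : ℝ, 0 ≤ c ∧ ∀ (V : Type) (G : SimpleGraph V) (U : Finset V),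
      (∀ A ⊆ U, ∀ B ⊆ U, #A = s → #B = t → ¬ ∀ a ∈ A, ∀ b ∈ B, G.Adj a b) →
      (#{S ∈ U.powersetCard (k + 1) | G.IsNClique (k + 1) S} : ℝ) ≤
        c * (#U : ℝ) ^ ((k + 1 : ℝ) - (k + 1) * k / (2 * s)) := by
  induction k generalizing s with
  | zero =>
    refine ⟨1, zero_le_one, fun V G U _ => ?_⟩
    have : #{S ∈ U.powersetCard (0 + 1) | G.IsNClique (0 + 1) S} ≤ #U :=
      (card_filter_le _ _).trans (by simp)
    simpa using this
  | succ k ih =>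
    obtain ⟨s, rfl⟩ : ∃ r, s = r + 1 := ⟨s - 1, by omega⟩
    obtain ⟨c, hc, hcl⟩ := ih s (by omega)
    set e : ℝ := (k + 1 : ℝ) - (k + 1) * k / (2 * s) with he
    set c' : ℝ := (((s + 1) ^ (s + 1) * ((s + 1).factorial * t + 1) : ℕ) : ℝ) with hc'
    have hks' : (k : ℝ) ≤ s := by exact_mod_cast (by omega : k ≤ s)
    have hfrac : ((k + 1) * k / (2 * s) : ℝ) ≤ k + 1 := by
      refine div_le_of_le_mul₀ (by positivity) (by positivity) ?_
      nlinarith [(Nat.cast_nonneg k : (0 : ℝ) ≤ k)]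
    refine ⟨c * (1 + c'), by positivity, fun V G U hfree => ?_⟩
    rcases U.eq_empty_or_nonempty with rfl | hU
    · rw [filter_eq_empty_iff.2]
      · simp only [card_empty, Nat.cast_zero]
        positivity
      · intro S hS
        rw [powersetCard_eq_empty.2 (by simp)] at hS
        simp at hS
    let nb : V → Finset V := fun v => {w ∈ U | G.Adj v w}
    have hcover : {S ∈ U.powersetCard (k + 1 + 1) | G.IsNClique (k + 1 + 1) S} ⊆
        U.biUnion fun v =>
          ({S ∈ (nb v).powersetCard (k + 1) | G.IsNClique (k + 1) S}).image (insert v) := by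
      intro S hS
      rw [mem_filter, mem_powersetCard] at hS
      obtain ⟨⟨hSU, hcard⟩, hSc, -⟩ := hS
      obtain ⟨v, hv⟩ : S.Nonempty := card_pos.1 (by omega)
      refine mem_biUnion.2 ⟨v, hSU hv, mem_image.2 ⟨S.erase v, ?_, insert_erase hv⟩⟩
      rw [mem_filter, mem_powersetCard, card_erase_of_mem hv, hcard]
      refine ⟨⟨fun w hw => ?_, rfl⟩, hSc.subset (by simp), by rw [card_erase_of_mem hv, hcard]; rfl⟩
      rw [mem_erase] at hw
      exact mem_filter.2 ⟨hSU hw.2, hSc hv hw.2 hw.1.symm⟩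
    have hnb : ∀ v ∈ U, (#{S ∈ (nb v).powersetCard (k + 1) | G.IsNClique (k + 1) S} : ℝ) ≤
        c * (#(nb v) : ℝ) ^ e := by
      intro v hv
      refine hcl V G (nb v) fun A hA B hB hAs hBt hAB => ?_
      have hvA : v ∉ A := fun h => G.loopless.irrefl v (mem_filter.1 (hA h)).2
      refine hfree (insert v A) (insert_subset hv (hA.trans (filter_subset _ _))) B
        (hB.trans (filter_subset _ _)) (by rw [card_insert_of_notMem hvA, hAs]) hBt ?_
      intro a ha b hb
      rcases mem_insert.1 ha with rfl | ha
      · exact (mem_filter.1 (hB hb)).2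
      · exact hAB a ha b hb
    have hmoment : ∑ v ∈ U, (#(nb v) : ℝ) ^ (s + 1) ≤ c' * (#U : ℝ) ^ (s + 1) := by
      rw [hc']
      exact_mod_cast sum_degree_pow_le G U (Nat.succ_ne_zero s) hfree
    have hpm := sum_rpow_le_of_sum_pow_le U hU (fun v => #(nb v)) (Nat.succ_ne_zero s)
      (e := e) (by rw [he]; linarith) (by
        have : (0 : ℝ) ≤ (k + 1) * k / (2 * s) := by positivity
        push_cast; linarith) hmoment
    have hexp : 1 + e * (1 - 1 / ((s + 1 : ℕ) : ℝ)) =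
        ((k + 1 : ℕ) + 1 : ℝ) - ((k + 1 : ℕ) + 1) * (k + 1 : ℕ) / (2 * (s + 1 : ℕ)) := by
      rw [he]
      push_cast
      rcases Nat.eq_zero_or_pos s with rfl | hs
      · obtain rfl : k = 0 := by omega
        norm_num
      · have : (s : ℝ) ≠ 0 := by positivity
        field_simp
        ring
    rw [← hexp]
    calc (#{S ∈ U.powersetCard (k + 1 + 1) | G.IsNClique (k + 1 + 1) S} : ℝ)
        ≤ ∑ v ∈ U, (#{S ∈ (nb v).powersetCard (k + 1) | G.IsNClique (k + 1) S} : ℝ) := by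
          exact_mod_cast (card_le_card hcover).trans
            (card_biUnion_le.trans (sum_le_sum fun v _ => card_image_le))
      _ ≤ ∑ v ∈ U, c * (#(nb v) : ℝ) ^ e := sum_le_sum hnb
      _ = c * ∑ v ∈ U, (#(nb v) : ℝ) ^ e := by rw [mul_sum]
      _ ≤ c * ((1 + c') * _) := mul_le_mul_of_nonneg_left hpm hc
      _ = _ := by rw [mul_assoc]

theorem Nat.exists_prime_pow_le_lt {s n : ℕ} (hs : s ≠ 0) (hn : 2 ^ s ≤ n) :
    ∃ p : ℕ, p.Prime ∧ p ^ s ≤ n ∧ n < (2 * p) ^ s := by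
  set r := Nat.findGreatest (fun r => r ^ s ≤ n) n
  have h2n : 2 ≤ n := (Nat.le_self_pow hs 2).trans hn
  have hr : r ^ s ≤ n := Nat.findGreatest_spec (P := fun r => r ^ s ≤ n) h2n hn
  have hr2 : 2 ≤ r := Nat.le_findGreatest h2n hn
  have hlt : n < (r + 1) ^ s := by
    by_contra! h
    exact (Nat.lt_succ_self r).not_ge
      (Nat.le_findGreatest (P := fun r => r ^ s ≤ n) ((Nat.le_self_pow hs _).trans h) h)
  obtain ⟨p, hp, h1, h2⟩ := Nat.exists_prime_lt_and_le_two_mul (r / 2) (by omega)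
  exact ⟨p, hp, (Nat.pow_le_pow_left (by omega) s).trans hr,
    hlt.trans_le (Nat.pow_le_pow_left (by omega) s)⟩

theorem exists_balanced_partition (V : Type*) [Finite V] (m : ℕ) (hm : m ≠ 0) :
    ∃ col : V → Fin m, ∀ i, Nat.card V / m ≤ Nat.card {x // col x = i} := by
  let e := Finite.equivFin V
  refine ⟨fun x => ⟨e x % m, Nat.mod_lt _ (Nat.pos_of_ne_zero hm)⟩, fun i => ?_⟩
  have hlt : ∀ u : Fin (Nat.card V / m), m * u + i < Nat.card V := fun u =>
    calc m * u + i < m * (u + 1) := by rw [mul_add]; omega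
      _ ≤ m * (Nat.card V / m) := Nat.mul_le_mul_left _ u.2
      _ ≤ Nat.card V := Nat.mul_div_le _ _
  conv_lhs => rw [← Nat.card_fin (Nat.card V / m)]
  refine Nat.card_le_card_of_injective
    (fun u : Fin (Nat.card V / m) => ⟨e.symm ⟨m * u + i, hlt u⟩, ?_⟩) fun u w huw => ?_
  · ext
    simp [Nat.mod_eq_of_lt i.2]
  · simp only [Subtype.mk.injEq, EmbeddingLike.apply_eq_iff_eq, Fin.mk.injEq,
      Nat.add_right_cancel_iff] at huw
    exact Fin.ext (Nat.eq_of_mul_eq_mul_left (Nat.pos_of_ne_zero hm) huw)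

open Finset in
/-- A graph whose `s`-sets have fewer than `t` common neighbours stays `K_{s,t}`-free when
isolated vertices are added. -/
theorem exists_graph_fin_of_graph {V : Type*} [Finite V] {s m t n : ℕ} (hs : s ≠ 0) (ht : t ≠ 0)
    (hn : Nat.card V ≤ n) (G : SimpleGraph V)
    (hG : ∀ A B : Finset V, #A = s → (∀ a ∈ A, ∀ b ∈ B, G.Adj a b) → #B < t) :
    ∃ H : SimpleGraph (Fin n), ¬ ContainsKst H s t ∧
      Nat.card {S : Finset V // G.IsNClique m S} ≤
        Nat.card {S : Finset (Fin n) // H.IsNClique m S} := by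
  classical
  let e : V ↪ Fin n := (Finite.equivFin V).toEmbedding.trans (Fin.castLEEmb hn)
  refine ⟨G.map e, ?_, ?_⟩
  · rintro ⟨A, B, -, hA, hB, hAB⟩
    obtain ⟨a₀, ha₀⟩ : A.Nonempty := card_pos.1 (by omega)
    obtain ⟨b₀, hb₀⟩ : B.Nonempty := card_pos.1 (by omega)
    have hmap : ∀ C : Finset (Fin n), (∀ x ∈ C, x ∈ Set.range e) →
        (C.preimage e e.injective.injOn).map e = C := fun C hC => by
      rw [map_eq_image, image_preimage, filter_true_of_mem hC]
    have hA' := hmap A fun a ha => by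
      obtain ⟨-, u, v, -, hu, -⟩ := hAB a ha b₀ hb₀
      exact ⟨u, hu⟩
    have hB' := hmap B fun b hb => by
      obtain ⟨-, u, v, -, -, hv⟩ := hAB a₀ ha₀ b hb
      exact ⟨v, hv⟩
    have hlt := hG (A.preimage e e.injective.injOn) (B.preimage e e.injective.injOn)
      (by rw [← hA, ← card_map e, hA']) fun a ha b hb =>
        (SimpleGraph.map_adj_apply (f := e)).1
          (hAB _ (mem_preimage.1 ha) _ (mem_preimage.1 hb))
    rw [← card_map e, hB', hB] at hlt
    exact lt_irrefl _ hlt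
  · refine Nat.card_le_card_of_injective
      (fun S => ⟨S.1.map e, S.2.map⟩) fun S T hST => ?_
    exact Subtype.ext (map_injective e (congrArg Subtype.val hST))

/-- Lower bound: some `K_{s,t}`-free graph on `n` vertices has many `m`-cliques. -/
theorem exists_graph_many_cliques (s m : ℕ) (hs : s ≠ 0) (hm : m ≠ 0) :
    ∃ f : ℕ, ∀ t ≥ f, ∀ n ≥ 2 ^ s * m, ∃ G : SimpleGraph (Fin n), ¬ ContainsKst G s t ∧
      ((2 ^ (s + 1) * m : ℝ) ^ m)⁻¹ * (n : ℝ) ^ ((m : ℝ) - m * (m - 1) / (2 * s)) ≤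
        (Nat.card {S : Finset (Fin n) // G.IsNClique m S} : ℝ) := by
  obtain ⟨D, hD⟩ := exists_bound_card_norm_add_eq s hs
  refine ⟨m * D + 1, fun t ht n hn => ?_⟩
  obtain ⟨p, hp, hpn, hnp⟩ := Nat.exists_prime_pow_le_lt hs
    ((Nat.le_mul_of_pos_right _ (Nat.pos_of_ne_zero hm)).trans hn)
  have : Fact p.Prime := ⟨hp⟩
  have : Fintype (GaloisField p s) := Fintype.ofFinite _
  have hcard : Nat.card (GaloisField p s) = p ^ s := GaloisField.card p s hs
  obtain ⟨col, hcol⟩ := exists_balanced_partition (GaloisField p s) m hm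
  rw [hcard] at hcol
  let N : Sym2 (GaloisField p s) → ZMod p :=
    Sym2.lift ⟨fun x y => Algebra.norm (ZMod p) (x + y), fun x y => by simp only [add_comm]⟩
  obtain ⟨G, hG, hGc⟩ := exists_graph_of_pair_coloring N (fun x hx c => hD p x hx c) col hcol
  obtain ⟨H, hH, hHc⟩ := exists_graph_fin_of_graph (m := m) (t := t) (n := n) hs (by omega)
    (hcard.trans_le hpn) G fun A B hA hAB => (hG A B hA hAB).trans_lt (by omega)
  refine ⟨H, hH, le_trans ?_ (Nat.cast_le.2 hHc)⟩
  rw [ZMod.card] at hGc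
  set c := Nat.card {S : Finset (GaloisField p s) // G.IsNClique m S}
  have hm0 : (0 : ℝ) < m := by positivity
  have hp0 : (0 : ℝ) < p := by exact_mod_cast hp.pos
  have hn0 : (0 : ℝ) < n := by exact_mod_cast (pow_pos hp.pos s).trans_le hpn
  have hk : (n : ℝ) / (2 ^ (s + 1) * m) ≤ (p ^ s / m : ℕ) := by
    have h1 : m ≤ p ^ s := by
      rw [mul_pow] at hnp
      exact (Nat.lt_of_mul_lt_mul_left (hn.trans_lt hnp)).le
    have h2 : p ^ s < 2 * m * (p ^ s / m) := by
      have h3 := Nat.div_add_mod (p ^ s) m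
      have h4 := Nat.mod_lt (p ^ s) (Nat.pos_of_ne_zero hm)
      have h5 : m * 1 ≤ m * (p ^ s / m) :=
        Nat.mul_le_mul_left m (Nat.div_pos h1 (Nat.pos_of_ne_zero hm))
      rw [mul_assoc]
      omega
    have h6 : n ≤ 2 ^ (s + 1) * m * (p ^ s / m) := by
      rw [mul_pow] at hnp
      calc n ≤ 2 ^ s * p ^ s := hnp.le
        _ ≤ 2 ^ s * (2 * m * (p ^ s / m)) := Nat.mul_le_mul_left _ h2.le
        _ = _ := by ring
    rw [div_le_iff₀' (by positivity)]
    exact_mod_cast h6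
  have hpow : (p : ℝ) ^ m.choose 2 ≤ (n : ℝ) ^ ((m : ℝ) * (m - 1) / (2 * s)) := by
    have h1 : (p : ℝ) ≤ (n : ℝ) ^ (1 / (s : ℝ)) := by
      rw [one_div, Real.le_rpow_inv_iff_of_pos hp0.le hn0.le (by positivity), Real.rpow_natCast]
      exact_mod_cast hpn
    calc (p : ℝ) ^ m.choose 2 ≤ ((n : ℝ) ^ (1 / (s : ℝ))) ^ m.choose 2 := by gcongr
      _ = (n : ℝ) ^ ((m : ℝ) * (m - 1) / (2 * s)) := by
        rw [← Real.rpow_natCast, ← Real.rpow_mul hn0.le, Nat.cast_choose_two]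
        congr 1
        field_simp
  have hGc' : ((p ^ s / m : ℕ) : ℝ) ^ m ≤ (p : ℝ) ^ m.choose 2 * c := by exact_mod_cast hGc
  rw [Real.rpow_sub hn0, Real.rpow_natCast, ← mul_div_assoc, div_le_iff₀ (by positivity)]
  calc ((2 ^ (s + 1) * m : ℝ) ^ m)⁻¹ * (n : ℝ) ^ m = ((n : ℝ) / (2 ^ (s + 1) * m)) ^ m := by
        rw [div_pow, div_eq_inv_mul]
    _ ≤ ((p ^ s / m : ℕ) : ℝ) ^ m := by gcongr
    _ ≤ (p : ℝ) ^ m.choose 2 * c := hGc'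
    _ ≤ (n : ℝ) ^ ((m : ℝ) * (m - 1) / (2 * s)) * c := by gcongr
    _ = _ := mul_comm _ _

/-- Corollary 1.5: for `s ≥ m-1 ≥ 1` there is `f(s,m)` such that for every
`t ≥ f(s,m)`, `ex(n, K_m, K_{s,t}) = Θ(n^{m - m(m-1)/(2s)})`: every `n`-vertex
`K_{s,t}`-free graph has at most `C₂ n^{…}` copies of `K_m`, and some
`K_{s,t}`-free graph has at least `C₁ n^{…}` copies of `K_m`, for large `n`. -/
theorem count_cliques_in_Kst_free
    (s m : ℕ) (hm : 2 ≤ m) (hsm : m - 1 ≤ s) :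
    ∃ f : ℕ, ∀ t : ℕ, f ≤ t →
      ∃ C₁ C₂ : ℝ, 0 < C₁ ∧ C₁ < C₂ ∧
        ∃ n₀ : ℕ, ∀ n ≥ n₀,
          (∀ G : SimpleGraph (Fin n), ¬ ContainsKst G s t →
            (Nat.card {S : Finset (Fin n) // G.IsNClique m S} : ℝ) ≤
              C₂ * (n : ℝ) ^ ((m : ℝ) - m * (m - 1) / (2 * s))) ∧
          (∃ G : SimpleGraph (Fin n), ¬ ContainsKst G s t ∧
            C₁ * (n : ℝ) ^ ((m : ℝ) - m * (m - 1) / (2 * s)) ≤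
              (Nat.card {S : Finset (Fin n) // G.IsNClique m S} : ℝ)) := by
  have hs : s ≠ 0 := by omega
  obtain ⟨f, hf⟩ := exists_graph_many_cliques s m hs (by omega)
  refine ⟨f, fun t ht => ?_⟩
  obtain ⟨c, -, hcl⟩ := exists_card_cliques_le (m - 1) s t hsm
  set C₁ : ℝ := ((2 ^ (s + 1) * m : ℝ) ^ m)⁻¹
  refine ⟨C₁, max c (C₁ + 1), by positivity, lt_max_of_lt_right (lt_add_one _), 2 ^ s * m,
    fun n hn => ⟨fun G hG => ?_, hf t ht n hn⟩⟩
  have hle := hcl (Fin n) G Finset.univ fun A _ B _ hA hB hAB =>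
    hG ⟨A, B, Finset.disjoint_left.2 fun x hxA hxB => G.loopless.irrefl x (hAB x hxA x hxB),
      hA, hB, hAB⟩
  have hm1 : m - 1 + 1 = m := by omega
  rw [hm1, Nat.cast_sub (by omega), Nat.cast_one, sub_add_cancel, Finset.card_univ,
    Fintype.card_fin] at hle
  refine le_trans (Nat.cast_le.2 (Nat.subtype_card _ fun S => ?_).le)
    (hle.trans (mul_le_mul_of_nonneg_right (le_max_left _ _) (by positivity)))
  simp only [Finset.mem_filter, Finset.mem_powersetCard_univ, and_iff_right_iff_imp]
  exact fun h => h.card_eq
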